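/- arXiv:2605.15039 — 3 statements merged into one kernel-verified Lean document; each statement's English description precedes it below -/
import Mathlib

section
/- Let G be a graph on six vertices whose degree sequence is d₁ ≤ d₂ ≤ … ≤ d₆. If d₁ ≥ 2 and d₂ ≥ 3, then G is Hamiltonian. -/
open SimpleGraph

namespace SimpleGraph

variable {V : Type*} {G : SimpleGraph V}

lemma isHamiltonian_of_forall_adj_succ [Fintype V] [DecidableEq V] (f : Fin 6 ≃ V)
    (hf : ∀ i, G.Adj (f i) (f (i + 1))) : G.IsHamiltonian := by
  intro _
  have hcopy : cycleGraph 6 ⊑ G := by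
    refine ⟨⟨⟨f, fun {i j} hij ↦ ?_⟩, f.injective⟩⟩
    rcases cycleGraph_adj.1 hij with h | h
    · rw [sub_eq_iff_eq_add'.1 h, add_comm]
      simpa [add_comm] using (hf j).symm
    · rw [sub_eq_iff_eq_add'.1 h]
      exact hf i
  obtain ⟨v, p, hp, hlen⟩ := (cycleGraph_isContained_iff (by norm_num)).1 hcopy
  refine ⟨v, p, Walk.isHamiltonianCycle_iff_isCycle_and_length_eq.2 ⟨hp, ?_⟩⟩
  rw [hlen, ← Fintype.card_congr f, Fintype.card_fin]

open Classical in
lemma ncard_neighborSet_eq_sum {ι : Type*} [Fintype ι] (f : ι ≃ V) (v : V) :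
    (G.neighborSet v).ncard = ∑ i, if G.Adj v (f i) then 1 else 0 := by
  rw [← Set.ncard_preimage_of_injective_subset_range f.injective (by simp),
    ← Finset.card_filter, ← Set.ncard_coe_finset]
  congr 1
  ext i
  simp

/-- A Hamiltonian path whose ends have degree at least three closes up to a Hamiltonian cycle. -/
lemma exists_cyclic_of_path (f : Fin 6 ≃ V) (hf : ∀ i, i ≠ 5 → G.Adj (f i) (f (i + 1)))
    (h0 : 3 ≤ (G.neighborSet (f 0)).ncard) (h5 : 3 ≤ (G.neighborSet (f 5)).ncard) :
    ∃ g : Fin 6 ≃ V, ∀ i, G.Adj (g i) (g (i + 1)) := by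
  by_cases h05 : G.Adj (f 5) (f 0)
  · refine ⟨f, fun i ↦ ?_⟩
    by_cases hi : i = 5
    · subst hi; exact h05
    · exact hf i hi
  have p0 : G.Adj (f 0) (f 1) := hf 0 (by decide)
  have p1 : G.Adj (f 1) (f 2) := hf 1 (by decide)
  have p2 : G.Adj (f 2) (f 3) := hf 2 (by decide)
  have p3 : G.Adj (f 3) (f 4) := hf 3 (by decide)
  have p4 : G.Adj (f 4) (f 5) := hf 4 (by decide)
  have crossing : (G.Adj (f 0) (f 2) ∧ G.Adj (f 5) (f 1)) ∨
      (G.Adj (f 0) (f 3) ∧ G.Adj (f 5) (f 2)) ∨ (G.Adj (f 0) (f 4) ∧ G.Adj (f 5) (f 3)) := by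
    rw [ncard_neighborSet_eq_sum f, Fin.sum_univ_six] at h0 h5
    have h50 : ¬ G.Adj (f 0) (f 5) := fun h ↦ h05 h.symm
    simp only [SimpleGraph.irrefl, if_false, h05, h50, p0, p4.symm, if_true] at h0 h5
    by_contra! hcon
    obtain ⟨c1, c2, c3⟩ := hcon
    split_ifs at h0 h5 <;> first | omega | tauto
  have reorder (σ : Fin 6 → Fin 6) (hσ : σ.Injective)
      (h : ∀ i, G.Adj (f (σ i)) (f (σ (i + 1)))) :
      ∃ g : Fin 6 ≃ V, ∀ i, G.Adj (g i) (g (i + 1)) :=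
    ⟨(Equiv.ofBijective σ (Finite.injective_iff_bijective.1 hσ)).trans f, h⟩
  rcases crossing with ⟨a, b⟩ | ⟨a, b⟩ | ⟨a, b⟩
  · refine reorder ![0, 2, 3, 4, 5, 1] (by decide) fun i ↦ ?_
    fin_cases i
    exacts [a, p2, p3, p4, b, p0.symm]
  · refine reorder ![0, 3, 4, 5, 2, 1] (by decide) fun i ↦ ?_
    fin_cases i
    exacts [a, p3, p4, b, p1.symm, p0.symm]
  · refine reorder ![0, 4, 5, 3, 2, 1] (by decide) fun i ↦ ?_
    fin_cases i
    exacts [a, p4, b, p2.symm, p1.symm, p0.symm]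

/-- The Bondy–Chvátal closure step on six vertices. -/
lemma exists_cyclic_of_sup_edge {u v : V} (hu : 3 ≤ (G.neighborSet u).ncard)
    (hv : 3 ≤ (G.neighborSet v).ncard) (f : Fin 6 ≃ V)
    (hf : ∀ i, (G ⊔ edge u v).Adj (f i) (f (i + 1))) :
    ∃ g : Fin 6 ≃ V, ∀ i, G.Adj (g i) (g (i + 1)) := by
  by_cases hall : ∀ i, G.Adj (f i) (f (i + 1))
  · exact ⟨f, hall⟩
  push Not at hall
  obtain ⟨i, hi⟩ := hall
  have huv : (f i = u ∧ f (i + 1) = v) ∨ (f i = v ∧ f (i + 1) = u) :=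
    ((edge_adj ..).1 ((hf i).resolve_left hi)).1
  have hnext : i + 1 + 5 = i := by
    rw [add_assoc]; exact add_zero i
  refine exists_cyclic_of_path ((Equiv.addLeft (i + 1)).trans f) (fun j hj ↦ ?_) ?_ ?_
  · have hadj := hf (i + 1 + j)
    rw [sup_adj, edge_adj] at hadj
    simp only [Equiv.trans_apply, Equiv.coe_addLeft, ← add_assoc]
    refine hadj.resolve_right fun hcon ↦ ?_
    have key : ∀ i j : Fin 6, j ≠ 5 → i + 1 + j ≠ i ∧ ¬ (i + 1 + j = i + 1 ∧ i + 1 + j + 1 = i) := by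
      decide
    obtain ⟨k1, k2⟩ := key i j hj
    rw [← f.injective.ne_iff] at k1
    rw [← f.injective.eq_iff, ← f.injective.eq_iff] at k2
    grind
  · simp only [Equiv.trans_apply, Equiv.coe_addLeft, add_zero]
    rcases huv with ⟨-, h⟩ | ⟨-, h⟩ <;> rwa [h]
  · simp only [Equiv.trans_apply, Equiv.coe_addLeft, hnext]
    rcases huv with ⟨h, -⟩ | ⟨h, -⟩ <;> rwa [h]

lemma exists_cyclic_of_clique_compl_singleton [DecidableEq V] (e : Fin 6 ≃ V) (a : V)
    (ha : 2 ≤ (G.neighborSet a).ncard) (hG : ∀ u v, u ≠ a → v ≠ a → u ≠ v → G.Adj u v) :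
    ∃ g : Fin 6 ≃ V, ∀ i, G.Adj (g i) (g (i + 1)) := by
  have : Finite V := .of_equiv _ e
  obtain ⟨b, hb, c, hc, hbc⟩ := (Set.one_lt_ncard (Set.toFinite _)).1 ha
  rw [mem_neighborSet] at hb hc
  obtain ⟨g, g0, g1, g5⟩ : ∃ g : Fin 6 ≃ V, g 0 = a ∧ g 1 = b ∧ g 5 = c := by
    obtain ⟨g, g0⟩ : ∃ g : Fin 6 ≃ V, g 0 = a := ⟨e.trans (Equiv.swap (e 0) a), by simp⟩
    obtain ⟨g', g0', g1'⟩ : ∃ g : Fin 6 ≃ V, g 0 = a ∧ g 1 = b := by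
      refine ⟨g.trans (Equiv.swap (g 1) b), ?_, by simp⟩
      rw [Equiv.trans_apply, g0, Equiv.swap_apply_of_ne_of_ne _ hb.ne]
      rw [← g0]; exact g.injective.ne (by decide)
    refine ⟨g'.trans (Equiv.swap (g' 5) c), ?_, ?_, by simp⟩
    · rw [Equiv.trans_apply, g0', Equiv.swap_apply_of_ne_of_ne _ hc.ne]
      rw [← g0']; exact g'.injective.ne (by decide)
    · rw [Equiv.trans_apply, g1', Equiv.swap_apply_of_ne_of_ne _ hbc]
      rw [← g1']; exact g'.injective.ne (by decide)
  refine ⟨g, fun i ↦ ?_⟩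
  by_cases h0 : i = 0
  · subst h0; rw [zero_add, g0, g1]; exact hb
  by_cases h5 : i = 5
  · subst h5
    rw [show (5 : Fin 6) + 1 = 0 from rfl, g0, g5]; exact hc.symm
  have key : ∀ i : Fin 6, i ≠ 5 → i + 1 ≠ 0 ∧ i ≠ i + 1 := by decide
  rw [← g0] at hG
  exact hG _ _ (g.injective.ne h0) (g.injective.ne (key i h5).1) (g.injective.ne (key i h5).2)

lemma exists_cyclic_of_ncard_neighborSet [DecidableEq V] (e : Fin 6 ≃ V) (a : V)
    (ha : 2 ≤ (G.neighborSet a).ncard) (hG : ∀ u, u ≠ a → 3 ≤ (G.neighborSet u).ncard) :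
    ∃ g : Fin 6 ≃ V, ∀ i, G.Adj (g i) (g (i + 1)) := by
  have : Finite V := .of_equiv _ e
  induction G using WellFoundedGT.induction with
  | ind G ih =>
  by_cases hclique : ∀ u v, u ≠ a → v ≠ a → u ≠ v → G.Adj u v
  · exact exists_cyclic_of_clique_compl_singleton e a ha hclique
  push Not at hclique
  obtain ⟨u, v, hu, hv, huv, hadj⟩ := hclique
  have hmono (w : V) : (G.neighborSet w).ncard ≤ ((G ⊔ edge u v).neighborSet w).ncard :=
    Set.ncard_le_ncard (fun _ h ↦ Or.inl h) (Set.toFinite _)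
  obtain ⟨f, hf⟩ := ih _ (lt_sup_edge G u v huv hadj) (ha.trans (hmono a))
    fun w hw ↦ (hG w hw).trans (hmono w)
  exact exists_cyclic_of_sup_edge (hG u hu) (hG v hv) f hf

end SimpleGraph

theorem stmt11 {V : Type*} [Fintype V] [DecidableEq V] (G : SimpleGraph V)
    (hcard : Fintype.card V = 6)
    (d : Fin 6 → ℕ) (v : Fin 6 ≃ V) (hmono : Monotone d)
    (hdeg : ∀ i : Fin 6, (G.neighborSet (v i)).ncard = d i)
    (h1 : 2 ≤ d 0) (h2 : 3 ≤ d 1) :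
    G.IsHamiltonian := by
  obtain ⟨g, hg⟩ := exists_cyclic_of_ncard_neighborSet (G := G) v (v 0) (by rwa [hdeg])
    fun u hu ↦ by
      obtain ⟨i, rfl⟩ := v.surjective u
      rw [hdeg]
      exact h2.trans (hmono (Fin.one_le_of_ne_zero fun hi ↦ hu (by rw [hi])))
  exact isHamiltonian_of_forall_adj_succ g hg
end

section
/- Let G be a graph on six vertices whose degree sequence is d₁ ≤ d₂ ≤ … ≤ d₆ with d₁ = d₂ = 2 and d₃ ≥ 3. Then G is Hamiltonian, except in exactly the following two cases: the two vertices of degree 2 are nonadjacent and have the same pair of neighbors; or G is isomorphic to the graph J. -/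
open SimpleGraph

/-- The graph `J`, with vertices `0 = x`, `1 = y`, `2 = v₁`, `3 = v₂`,
`4 = v₃`, `5 = v₄`: the triangle `v₂v₃v₄`, `v₁` joined to everything else,
and the edge `xy`. -/
def Jgraph : SimpleGraph (Fin 6) :=
  SimpleGraph.fromEdgeSet
    {s(0, 1), s(0, 2), s(1, 2), s(2, 3), s(2, 4), s(2, 5), s(3, 4), s(4, 5), s(3, 5)}

/-- A graph with at least three vertices is Hamiltonian iff it contains a spanning cycle graph. -/
theorem isHamiltonian_iff_cycleGraph_isContained {V : Type*} [Fintype V] [DecidableEq V]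
    (G : SimpleGraph V) (h : 2 < Fintype.card V) :
    G.IsHamiltonian ↔ (cycleGraph (Fintype.card V)).IsContained G := by
  rw [cycleGraph_isContained_iff h]
  simp only [← Walk.isHamiltonianCycle_iff_isCycle_and_length_eq]
  exact ⟨fun hG ↦ hG (by omega), fun hG _ ↦ hG⟩

/-- A graph on six vertices is Hamiltonian iff its vertices can be arranged in a closed cyclic
order along edges. -/
theorem isHamiltonian_iff_exists_cyclic_order {V : Type*} [Fintype V] [DecidableEq V]
    (G : SimpleGraph V) (h : Fintype.card V = 6) :
    G.IsHamiltonian ↔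
      ∃ f : Fin 6 → V, Function.Injective f ∧ ∀ i, G.Adj (f i) (f (i + 1)) := by
  rw [isHamiltonian_iff_cycleGraph_isContained G (by omega), h]
  constructor
  · rintro ⟨c⟩
    refine ⟨c, c.injective, fun i ↦ c.toHom.map_adj ?_⟩
    rw [cycleGraph_adj]
    right
    simp
  · rintro ⟨f, hf, hadj⟩
    refine ⟨⟨⟨f, ?_⟩, hf⟩⟩
    intro a b hab
    rw [cycleGraph_adj] at hab
    rcases hab with hab | hab
    · have := (hadj b).symm
      rwa [← hab, add_sub_cancel] at this
    · have := hadj a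
      rwa [← hab, add_sub_cancel] at this

/-- The adjacency matrix of a graph on `Fin 6` with the listed upper triangular entries. -/
def symmMatrix (a b c d e f g h i j k l m n o : Bool) : Fin 6 → Fin 6 → Bool :=
  ![![false, a, b, c, d, e],
    ![a, false, f, g, h, i],
    ![b, f, false, j, k, l],
    ![c, g, j, false, m, n],
    ![d, h, k, m, false, o],
    ![e, i, l, n, o, false]]

theorem Jgraph_adj_iff (x y : Fin 6) : Jgraph.Adj x y ↔
    symmMatrix true true false false false true false false false true true true true true true
      x y = true := by
  simp only [Jgraph, fromEdgeSet_adj, Set.mem_insert_iff, Set.mem_singleton_iff]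
  revert x y
  decide

instance : DecidableRel Jgraph.Adj := fun x y ↦ decidable_of_iff' _ (Jgraph_adj_iff x y)

theorem not_isHamiltonian_Jgraph : ¬ Jgraph.IsHamiltonian := by
  rw [isHamiltonian_iff_exists_cyclic_order _ (by simp)]
  rintro ⟨f, hf, hadj⟩
  have key : ∀ a b, Jgraph.Adj a b → ∀ c, Jgraph.Adj b c → c ≠ a → ∀ d, Jgraph.Adj c d →
      d ≠ a → d ≠ b → ∀ e, Jgraph.Adj d e → e ≠ a → e ≠ b → e ≠ c → ∀ g, Jgraph.Adj e g →
      g ≠ a → g ≠ b → g ≠ c → g ≠ d → ¬ Jgraph.Adj g a := by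
    decide +kernel
  refine key (f 0) (f 1) (hadj 0) (f 2) (hadj 1) ?_ (f 3) (hadj 2) ?_ ?_ (f 4) (hadj 3) ?_ ?_ ?_
    (f 5) (hadj 4) ?_ ?_ ?_ ?_ (hadj 5) <;> exact hf.ne (by decide)

theorem not_isHamiltonian_of_iso_Jgraph {V : Type*} [Fintype V] [DecidableEq V]
    {G : SimpleGraph V} (e : G ≃g Jgraph) : ¬ G.IsHamiltonian := by
  intro hG
  have hc : Fintype.card V = 6 := by simpa using Fintype.card_congr e.toEquiv
  rw [isHamiltonian_iff_exists_cyclic_order G hc] at hG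
  obtain ⟨f, hf, hadj⟩ := hG
  refine not_isHamiltonian_Jgraph ((isHamiltonian_iff_exists_cyclic_order _ (by simp)).2
    ⟨e ∘ f, e.injective.comp hf, fun i ↦ e.map_adj_iff.2 (hadj i)⟩)

/-- In a Hamiltonian graph on six vertices, two distinct vertices cannot have the same two
neighbours. -/
theorem not_isHamiltonian_of_neighborSet_eq {V : Type*} [Fintype V] [DecidableEq V]
    {G : SimpleGraph V} (hc : Fintype.card V = 6) {x y : V} (hxy : x ≠ y)
    (hx : (G.neighborSet x).ncard = 2) (h : G.neighborSet x = G.neighborSet y) :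
    ¬ G.IsHamiltonian := by
  rw [isHamiltonian_iff_exists_cyclic_order G hc]
  rintro ⟨f, hf, hadj⟩
  have hsurj : Function.Surjective f :=
    ((Fintype.bijective_iff_injective_and_card f).2 ⟨hf, by simp [hc]⟩).2
  have hpred (i : Fin 6) : G.Adj (f i) (f (i - 1)) := by
    simpa using (hadj (i - 1)).symm
  obtain ⟨i, rfl⟩ := hsurj x
  obtain ⟨j, rfl⟩ := hsurj y
  have hN : G.neighborSet (f i) = {f (i + 1), f (i - 1)} := by
    have hne : f (i + 1) ≠ f (i - 1) := hf.ne ((by decide : ∀ i : Fin 6, i + 1 ≠ i - 1) i)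
    refine (Set.eq_of_subset_of_ncard_le ?_ ?_ (Set.toFinite _)).symm
    · rintro z (rfl | rfl)
      exacts [hadj i, hpred i]
    · rw [hx, Set.ncard_pair hne]
  have h₁ : f (j + 1) ∈ G.neighborSet (f i) := h ▸ hadj j
  have h₂ : f (j - 1) ∈ G.neighborSet (f i) := h ▸ hpred j
  simp only [hN, Set.mem_insert_iff, Set.mem_singleton_iff, hf.eq_iff] at h₁ h₂
  have hij : i ≠ j := fun hij ↦ hxy (congrArg f hij)
  clear hN h hx hxy
  revert i j
  decide

/-- The relation `A` admits a closed walk `0, p, q, r, s, t` through six distinct vertices. -/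
def HasClosedOrder (A : Fin 6 → Fin 6 → Bool) : Prop :=
  ∃ p, A 0 p ∧ ∃ q, A p q ∧ q ≠ 0 ∧ ∃ r, A q r ∧ r ≠ 0 ∧ r ≠ p ∧
    ∃ s, A r s ∧ s ≠ 0 ∧ s ≠ p ∧ s ≠ q ∧ ∃ t, A s t ∧ t ≠ 0 ∧ t ≠ p ∧ t ≠ q ∧ t ≠ r ∧ A t 0

instance : DecidablePred HasClosedOrder := fun A ↦ by
  unfold HasClosedOrder
  infer_instance

/-- Swapping `2` with some vertex turns the relation `A` into adjacency in `Jgraph`. -/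
def IsSwapOfJgraph (A : Fin 6 → Fin 6 → Bool) : Prop :=
  ∃ z, ∀ x y, A (Equiv.swap 2 z x) (Equiv.swap 2 z y) = decide (Jgraph.Adj x y)

instance : DecidablePred IsSwapOfJgraph := fun A ↦ by
  unfold IsSwapOfJgraph
  infer_instance

theorem symmMatrix_trichotomy :
    ∀ a b c d e, a.toNat + b.toNat + c.toNat + d.toNat + e.toNat = 2 →
    ∀ f g h i, a.toNat + f.toNat + g.toNat + h.toNat + i.toNat = 2 →
    ∀ j k l, 3 ≤ b.toNat + f.toNat + j.toNat + k.toNat + l.toNat →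
    ∀ m n, 3 ≤ c.toNat + g.toNat + j.toNat + m.toNat + n.toNat →
    ∀ o, 3 ≤ d.toNat + h.toNat + k.toNat + m.toNat + o.toNat →
    3 ≤ e.toNat + i.toNat + l.toNat + n.toNat + o.toNat →
    HasClosedOrder (symmMatrix a b c d e f g h i j k l m n o) ∨
    (a = false ∧ ∀ z, symmMatrix a b c d e f g h i j k l m n o 0 z =
      symmMatrix a b c d e f g h i j k l m n o 1 z) ∨
    IsSwapOfJgraph (symmMatrix a b c d e f g h i j k l m n o) := by
  decide +kernel

/-- A symmetric irreflexive relation on `Fin 6` with two rows of weight two, the others of weight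
at least three, has a closed Hamiltonian order, or equal first rows, or is a copy of `Jgraph`. -/
theorem trichotomy_of_degrees (A : Fin 6 → Fin 6 → Bool) (hsymm : ∀ i j, A i j = A j i)
    (hirr : ∀ i, A i i = false) (h₀ : ∑ j, (A 0 j).toNat = 2) (h₁ : ∑ j, (A 1 j).toNat = 2)
    (h : ∀ i, 2 ≤ i → 3 ≤ ∑ j, (A i j).toNat) :
    (∃ f : Fin 6 → Fin 6, Function.Injective f ∧ ∀ i, A (f i) (f (i + 1))) ∨
    (A 0 1 = false ∧ ∀ z, A 0 z = A 1 z) ∨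
    ∃ σ : Equiv.Perm (Fin 6), ∀ x y, A (σ x) (σ y) = decide (Jgraph.Adj x y) := by
  have hA : A = symmMatrix (A 0 1) (A 0 2) (A 0 3) (A 0 4) (A 0 5) (A 1 2) (A 1 3) (A 1 4) (A 1 5)
      (A 2 3) (A 2 4) (A 2 5) (A 3 4) (A 3 5) (A 4 5) := by
    funext i j
    fin_cases i <;> fin_cases j <;> first | exact hirr _ | rfl | exact hsymm _ _
  have h₂ := h 2 (by decide)
  have h₃ := h 3 (by decide)
  have h₄ := h 4 (by decide)
  have h₅ := h 5 (by decide)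
  simp only [Fin.sum_univ_six, hirr, Bool.toNat_false, hsymm 1 0, hsymm 2 0, hsymm 2 1, hsymm 3 0,
    hsymm 3 1, hsymm 3 2, hsymm 4 0, hsymm 4 1, hsymm 4 2, hsymm 4 3, hsymm 5 0, hsymm 5 1,
    hsymm 5 2, hsymm 5 3, hsymm 5 4, zero_add, add_zero] at h₀ h₁ h₂ h₃ h₄ h₅
  have key := symmMatrix_trichotomy _ _ _ _ _ h₀ _ _ _ _ h₁ _ _ _ h₂ _ _ h₃ _ h₄ h₅
  rw [← hA] at key
  refine key.imp ?_ (Or.imp_right fun ⟨z, hz⟩ ↦ ⟨_, hz⟩)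
  rintro ⟨p, hp, q, hq, hq0, r, hr, hr0, hrp, s, hs, hs0, hsp, hsq, t, ht, ht0, htp, htq, htr, ht'⟩
  have hne {x y : Fin 6} (hxy : A x y) : x ≠ y := by
    rintro rfl
    simp [hirr] at hxy
  refine ⟨![0, p, q, r, s, t], List.nodup_ofFn.1 ?_, ?_⟩
  · have := hne hp
    have := hne hq
    have := hne hr
    have := hne hs
    have := hne ht
    simp [List.ofFn_succ]
    grind
  · intro i
    fin_cases i
    exacts [hp, hq, hr, hs, ht, ht']

theorem stmt12 {V : Type*} [Fintype V] [DecidableEq V] (G : SimpleGraph V)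
    (hcard : Fintype.card V = 6)
    (d : Fin 6 → ℕ) (v : Fin 6 ≃ V) (hmono : Monotone d)
    (hdeg : ∀ i : Fin 6, (G.neighborSet (v i)).ncard = d i)
    (h1 : d 0 = 2) (h2 : d 1 = 2) (h3 : 3 ≤ d 2) :
    G.IsHamiltonian ↔
      ¬ ((¬ G.Adj (v 0) (v 1) ∧ G.neighborSet (v 0) = G.neighborSet (v 1)) ∨
        Nonempty (G ≃g Jgraph)) := by
  classical
  constructor
  · rintro hG (⟨-, h⟩ | ⟨⟨e⟩⟩)
    · exact not_isHamiltonian_of_neighborSet_eq hcard (v.injective.ne (by decide))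
        ((hdeg 0).trans h1) h hG
    · exact not_isHamiltonian_of_iso_Jgraph e hG
  · intro hex
    have hsum (i : Fin 6) : ∑ j, (decide (G.Adj (v i) (v j))).toNat = d i := by
      have hset : G.neighborSet (v i) =
          v '' ((Finset.univ.filter fun j ↦ G.Adj (v i) (v j) : Finset (Fin 6)) : Set (Fin 6)) := by
        ext y
        obtain ⟨j, rfl⟩ := v.surjective y
        simp
      rw [← hdeg, hset, Set.ncard_image_of_injective _ v.injective, Set.ncard_coe_finset,
        Finset.card_filter]
      exact Finset.sum_congr rfl fun j _ ↦ by by_cases h : G.Adj (v i) (v j) <;> simp [h]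
    rcases trichotomy_of_degrees (fun i j ↦ decide (G.Adj (v i) (v j)))
      (fun i j ↦ by simp [G.adj_comm]) (by simp) ((hsum 0).trans h1) ((hsum 1).trans h2)
      (fun i hi ↦ (hsum i).symm ▸ h3.trans (hmono hi)) with ⟨f, hf, hadj⟩ | ⟨h01, h⟩ | ⟨σ, hσ⟩
    · exact (isHamiltonian_iff_exists_cyclic_order G hcard).2
        ⟨v ∘ f, v.injective.comp hf, fun i ↦ by simpa using hadj i⟩
    · refine absurd (Or.inl ⟨by simpa using h01, ?_⟩) hex
      ext y
      obtain ⟨j, rfl⟩ := v.surjective y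
      simpa using h j
    · exact absurd (Or.inr ⟨(RelIso.mk (σ.trans v) fun {x y} ↦ by
        simpa using hσ x y : Jgraph ≃g G).symm⟩) hex
end

section
/- Let G be a 4-connected graph on seven vertices. Then G is W₆-minor-free if and only if G contains no vertex of degree 6. -/
open SimpleGraph

/-- `H` is a minor of `G`: there is a family of nonempty, pairwise disjoint,
connected branch sets in `G`, one for each vertex of `H`, such that adjacent
vertices of `H` have branch sets joined by an edge of `G`. -/
def SimpleGraph.IsMinorOf {W V : Type*} (H : SimpleGraph W) (G : SimpleGraph V) : Prop :=
  ∃ φ : W → Set V,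
    (∀ w, (φ w).Nonempty) ∧
    (∀ w, (G.induce (φ w)).Connected) ∧
    (Pairwise fun w₁ w₂ => Disjoint (φ w₁) (φ w₂)) ∧
    (∀ ⦃w₁ w₂⦄, H.Adj w₁ w₂ → ∃ a ∈ φ w₁, ∃ b ∈ φ w₂, G.Adj a b)

/-- The wheel `Wₙ`: a hub (`none`) joined to every vertex of a cycle of length `n`. -/
def wheel (n : ℕ) : SimpleGraph (Option (ZMod n)) :=
  SimpleGraph.fromRel fun a b =>
    (a = none ∧ b ≠ none) ∨ (∃ i j : ZMod n, a = some i ∧ b = some j ∧ j = i + 1)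

/-- A graph is 4-connected if it has at least five vertices and deleting any set
of at most three vertices leaves it connected. -/
def FourConnected {V : Type*} (G : SimpleGraph V) : Prop :=
  5 ≤ Nat.card V ∧ ∀ S : Set V, S.ncard ≤ 3 → (G.induce Sᶜ).Connected

/-- Dirac's theorem for six vertices: a relation on `Fin 6` of minimum degree at least three has
a Hamiltonian cycle. -/
theorem exists_perm_forall_rel_add_one (A : Fin 6 → Fin 6 → Prop)
    (hsymm : ∀ x y, A x y → A y x) (hirr : ∀ x, ¬ A x x)
    (hdeg : ∀ x, 3 ≤ {y | A x y}.ncard) :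
    ∃ σ : Equiv.Perm (Fin 6), ∀ i, A (σ i) (σ (i + 1)) := by
  classical
  obtain ⟨c, hc⟩ : ∃ c : Fin 6 → Fin 6 → ℕ, ∀ x y, c x y = if A x y then 1 else 0 :=
    ⟨fun x y => if A x y then 1 else 0, fun _ _ => rfl⟩
  have hcomm : ∀ x y, c x y = c y x := fun x y => by
    simp only [hc, show A x y ↔ A y x from ⟨hsymm _ _, hsymm _ _⟩]
  have hle : ∀ x y, c x y ≤ 1 := fun x y => by rw [hc]; split_ifs <;> simp
  let s : Equiv.Perm (Fin 6) → ℕ := fun σ => ∑ i, c (σ i) (σ (i + 1))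
  obtain ⟨σ, hσ⟩ := Finite.exists_max s
  refine ⟨σ, ?_⟩
  by_contra! hfail
  obtain ⟨k, hk⟩ := hfail
  obtain ⟨τ, hτ⟩ : ∃ τ : Equiv.Perm (Fin 6), τ = (Equiv.addRight (k + 1)).trans σ := ⟨_, rfl⟩
  have happ : ∀ i, τ i = σ (i + (k + 1)) := by simp [hτ, add_assoc]
  have hs : s τ = s σ := by
    refine Fintype.sum_equiv (Equiv.addRight (k + 1)) _ _ fun i => ?_
    simp only [happ, Equiv.coe_addRight, add_right_comm]
  have h50 : c (τ 5) (τ 0) = 0 := by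
    have h5 : (5 : Fin 6) + (k + 1) = k := by clear hk happ hs hτ; revert k; decide
    simpa [hc, happ, h5] using hk
  have hdeg' : ∀ x, 3 ≤ ∑ y, c (τ x) (τ y) := fun x => by
    refine (hdeg (τ x)).trans (le_of_eq ?_)
    rw [Equiv.sum_comp τ (c (τ x))]
    simp only [hc]
    rw [Finset.sum_boole, Set.ncard_eq_toFinset_card']
    simp
  have h0 := hdeg' 0
  have h5 := hdeg' 5
  have hself : ∀ x, c x x = 0 := fun x => by rw [hc, if_neg (hirr x)]
  have hmax : ∀ ρ : Equiv.Perm (Fin 6), s (ρ.trans τ) ≤ s τ := fun ρ => hs ▸ hσ _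
  have m1 := hmax ⟨![0, 1, 5, 4, 3, 2], ![0, 1, 5, 4, 3, 2], by decide, by decide⟩
  have m2 := hmax ⟨![0, 1, 2, 5, 4, 3], ![0, 1, 2, 5, 4, 3], by decide, by decide⟩
  have m3 := hmax ⟨![0, 1, 2, 3, 5, 4], ![0, 1, 2, 3, 5, 4], by decide, by decide⟩
  have e1 : (0 : Fin 6) + 1 = 1 := rfl
  have e2 : (1 : Fin 6) + 1 = 2 := rfl
  have e3 : (2 : Fin 6) + 1 = 3 := rfl
  have e4 : (3 : Fin 6) + 1 = 4 := rfl
  have e5 : (4 : Fin 6) + 1 = 5 := rfl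
  have e6 : (5 : Fin 6) + 1 = 0 := rfl
  simp only [s, Fin.sum_univ_six, Equiv.trans_apply, Equiv.coe_fn_mk, e1, e2, e3, e4, e5, e6,
    Matrix.cons_val, h50, hself, hcomm (τ 0) (τ 5), hcomm (τ 2) (τ 0), hcomm (τ 3) (τ 0),
    hcomm (τ 4) (τ 0), hcomm (τ 1) (τ 5), hcomm (τ 2) (τ 5), hcomm (τ 3) (τ 5),
    hcomm (τ 4) (τ 5), hcomm (τ 4) (τ 3), hcomm (τ 3) (τ 2)] at m1 m2 m3 h0 h5
  have := hle (τ 0) (τ 1)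
  have := hle (τ 0) (τ 2)
  have := hle (τ 0) (τ 3)
  have := hle (τ 0) (τ 4)
  have := hle (τ 5) (τ 1)
  have := hle (τ 5) (τ 2)
  have := hle (τ 5) (τ 3)
  have := hle (τ 5) (τ 4)
  have := hle (τ 1) (τ 2)
  have := hle (τ 2) (τ 3)
  have := hle (τ 3) (τ 4)
  omega

theorem FourConnected.four_le_ncard_neighborSet {V : Type*} {G : SimpleGraph V}
    (hG : FourConnected G) (u : V) : 4 ≤ (G.neighborSet u).ncard := by
  by_contra! hlt
  have hconn := hG.2 (G.neighborSet u) (by omega)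
  have : Finite V := Nat.finite_of_card_ne_zero (by have := hG.1; omega)
  have hex : ∃ w, w ∉ insert u (G.neighborSet u) := by
    by_contra! h
    have h1 := Set.ncard_insert_le u (G.neighborSet u)
    rw [Set.eq_univ_of_forall h, Set.ncard_univ] at h1
    have := hG.1
    omega
  obtain ⟨w, hw⟩ := hex
  rw [Set.mem_insert_iff, not_or] at hw
  let u' : ((G.neighborSet u)ᶜ : Set V) := ⟨u, by simp⟩
  let w' : ((G.neighborSet u)ᶜ : Set V) := ⟨w, hw.2⟩
  have : Nontrivial ((G.neighborSet u)ᶜ : Set V) :=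
    ⟨u', w', fun h => hw.1 (congrArg Subtype.val h).symm⟩
  obtain ⟨x, hx⟩ := hconn.preconnected.exists_adj_of_nontrivial u'
  exact x.2 hx

theorem wheel_isMinorOf_of_ncard_neighborSet_eq_six {V : Type*} {G : SimpleGraph V}
    (hG : FourConnected G) (hcard : Nat.card V = 7) {v : V}
    (hv : (G.neighborSet v).ncard = 6) : (wheel 6).IsMinorOf G := by
  have : Finite V := Nat.finite_of_card_ne_zero (by omega)
  have hcard6 : Nat.card (G.neighborSet v) = 6 := hv
  let e : Fin 6 ≃ G.neighborSet v := (Finite.equivFinOfCardEq hcard6).symm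
  have huniv : insert v (G.neighborSet v) = Set.univ := by
    rw [Set.eq_univ_iff_ncard]
    rw [Set.ncard_insert_of_notMem (by simp), hv, hcard]
  obtain ⟨σ, hσ⟩ := exists_perm_forall_rel_add_one (fun x y => G.Adj (e x) (e y))
    (fun _ _ h => h.symm) (fun _ => G.irrefl) fun x => by
      have h4 := hG.four_le_ncard_neighborSet (e x)
      have hsub : G.neighborSet (e x) ⊆
          insert v ((fun y => (e y : V)) '' {y | G.Adj (e x) (e y)}) := by
        intro y hy
        have hy' : y ∈ insert v (G.neighborSet v) := huniv ▸ Set.mem_univ y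
        refine hy'.imp id fun h => ⟨e.symm ⟨y, h⟩, ?_, ?_⟩
        · simpa using hy
        · simp
      have h1 := Set.ncard_le_ncard hsub (Set.toFinite _)
      have h2 := Set.ncard_insert_le v ((fun y => (e y : V)) '' {y | G.Adj (e x) (e y)})
      have h3 := Set.ncard_image_le (f := fun y => (e y : V))
        (Set.toFinite {y | G.Adj (e x) (e y)})
      omega
  let f : Option (ZMod 6) → V := fun w => w.elim v fun i => e (σ i)
  have hne : ∀ i : ZMod 6, v ≠ e (σ i) := fun i => (e (σ i)).2.ne
  have hf : Function.Injective f := by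
    rintro (_ | i) (_ | j) h
    · rfl
    · exact (hne j h).elim
    · exact (hne i h.symm).elim
    · exact congrArg some (σ.injective (e.injective (Subtype.ext h)))
  have hrel : ∀ a b : Option (ZMod 6), (a = none ∧ b ≠ none) ∨
      (∃ i j : ZMod 6, a = some i ∧ b = some j ∧ j = i + 1) → G.Adj (f a) (f b) := by
    rintro a b (⟨rfl, hb⟩ | ⟨i, j, rfl, rfl, rfl⟩)
    · obtain ⟨i, rfl⟩ := Option.ne_none_iff_exists'.1 hb
      exact (e (σ i)).2
    · exact hσ i
  refine ⟨fun w => {f w}, fun w => Set.singleton_nonempty _, fun w => ?_, fun a b hab => ?_,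
    fun a b hab => ⟨f a, rfl, f b, rfl, ?_⟩⟩
  · exact SimpleGraph.Connected.of_subsingleton
  · exact Set.disjoint_singleton.2 (hf.ne hab)
  · rw [wheel, SimpleGraph.fromRel_adj] at hab
    exact hab.2.elim (hrel a b) fun h => (hrel b a h).symm

theorem exists_ncard_neighborSet_eq_six_of_wheel_isMinorOf {V : Type*} {G : SimpleGraph V}
    (hcard : Nat.card V = 7) (h : (wheel 6).IsMinorOf G) :
    ∃ v : V, (G.neighborSet v).ncard = 6 := by
  obtain ⟨φ, hne, -, hdisj, hadj⟩ := h
  have : Finite V := Nat.finite_of_card_ne_zero (by omega)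
  choose f hf using hne
  have hinj : Function.Injective f := fun a b hab => by
    by_contra hne
    exact Set.disjoint_left.1 (hdisj hne) (hf a) (hab ▸ hf b)
  have hW : Nat.card (Option (ZMod 6)) = 7 := by simp
  have hbij := (Nat.bijective_iff_injective_and_card f).2 ⟨hinj, hW.trans hcard.symm⟩
  have hφ : ∀ w, ∀ x ∈ φ w, x = f w := fun w x hx => by
    obtain ⟨w', rfl⟩ := hbij.2 x
    by_contra hne
    exact Set.disjoint_left.1 (hdisj fun h => hne (congrArg f h)) (hf w') hx
  refine ⟨f none, ?_⟩
  have hset : G.neighborSet (f none) = {f none}ᶜ := by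
    ext x
    refine ⟨fun hx => hx.ne', fun hx => ?_⟩
    obtain ⟨w, rfl⟩ := hbij.2 x
    have hw : w ≠ none := fun h => hx (congrArg f h)
    obtain ⟨a, ha, b, hb, hab⟩ := hadj (w₁ := none) (w₂ := w) (by
      rw [wheel, SimpleGraph.fromRel_adj]
      exact ⟨hw.symm, Or.inl (Or.inl ⟨rfl, hw⟩)⟩)
    rwa [hφ _ a ha, hφ _ b hb] at hab
  have hcompl := Set.ncard_add_ncard_compl {f none}
  rw [Set.ncard_singleton, hcard] at hcompl
  rw [hset]
  omega

theorem stmt13 {V : Type*} (G : SimpleGraph V) (hG : FourConnected G)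
    (hcard : Nat.card V = 7) :
    ¬ (wheel 6).IsMinorOf G ↔ ∀ v : V, (G.neighborSet v).ncard ≠ 6 := by
  rw [← not_exists_not, not_iff_not]
  simp only [not_not]
  exact ⟨exists_ncard_neighborSet_eq_six_of_wheel_isMinorOf hcard,
    fun ⟨_, hv⟩ => wheel_isMinorOf_of_ncard_neighborSet_eq_six hG hcard hv⟩
end
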